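/- The limit, as N → ∞, of (Σ_{i=1}^{N} P(N,i) · (F(i) − 1)) / (N!)² equals e; that is, the normalizing constant of the maximum-RPS-entropy permutation mass function is asymptotically e · (N!)². -/

import Mathlib

/-- P(n,i) = n!/(n−i)!, the number of i-permutations of n (the division is exact for i ≤ n). -/
def P (n i : ℕ) : ℕ := n.factorial / (n - i).factorial

/-- F(i) = Σ_{j=0}^{i} P(i,j), the total number of permutation events over i elements. -/
def F (i : ℕ) : ℕ := ∑ j ∈ Finset.range (i + 1), P i j

lemma P_cast (n i : ℕ) : (P n i : ℝ) = n.factorial / (n - i).factorial := by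
  unfold P
  rw [Nat.cast_div (Nat.factorial_dvd_factorial (Nat.sub_le n i))]
  exact_mod_cast Nat.factorial_ne_zero _

lemma F_cast (i : ℕ) :
    (F i : ℝ) = i.factorial * ∑ k ∈ Finset.range (i + 1), (1 : ℝ) / k.factorial := by
  unfold F
  push_cast
  rw [Finset.mul_sum, ← Finset.sum_flip]
  refine Finset.sum_congr rfl fun j hj => ?_
  have hj' : j ≤ i := by simpa [Nat.lt_succ_iff] using hj
  rw [P_cast, Nat.sub_sub_self hj', mul_one_div]

lemma sum_inv_le (n : ℕ) :
    ∑ k ∈ Finset.range n, (1 : ℝ) / k.factorial ≤ Real.exp 1 := by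
  simpa using Real.sum_le_exp_of_nonneg (x := 1) zero_le_one n

lemma sum_inv_tendsto :
    Filter.Tendsto (fun n : ℕ => ∑ k ∈ Finset.range n, (1 : ℝ) / k.factorial)
      Filter.atTop (nhds (Real.exp 1)) := by
  have h := (NormedSpace.expSeries_div_hasSum_exp (1 : ℝ)).tendsto_sum_nat
  rw [← Real.exp_eq_exp_ℝ] at h
  simpa using h

lemma F_pos (i : ℕ) : 1 ≤ F i := by
  unfold F
  rw [Finset.sum_range_succ']
  simp [P, Nat.div_self (Nat.factorial_pos i)]

lemma rest_le (n : ℕ) :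
    ((∑ i ∈ Finset.Icc 1 n, P (n + 1) i * (F i - 1) : ℕ) : ℝ) / ((n + 1).factorial : ℝ) ^ 2
      ≤ Real.exp 1 * Real.exp 1 * (1 / ((n : ℝ) + 1)) := by
  have hf : (0 : ℝ) < n.factorial := by exact_mod_cast Nat.factorial_pos n
  have hn : (0 : ℝ) < (n : ℝ) + 1 := by positivity
  push_cast
  rw [Finset.sum_div]
  calc _ ≤ ∑ i ∈ Finset.Icc 1 n,
        (1 : ℝ) / (n + 1 - i).factorial * (Real.exp 1 * (1 / ((n : ℝ) + 1))) := by
        refine Finset.sum_le_sum fun i hi => ?_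
        have hi' : i ≤ n := (Finset.mem_Icc.1 hi).2
        have h1 : ((F i - 1 : ℕ) : ℝ) ≤ n.factorial * Real.exp 1 := by
          calc ((F i - 1 : ℕ) : ℝ) ≤ F i := by exact_mod_cast Nat.sub_le _ _
            _ ≤ _ := by
              rw [F_cast]
              have : (i.factorial : ℝ) ≤ n.factorial := by
                exact_mod_cast Nat.factorial_le hi'
              exact mul_le_mul this (sum_inv_le (i + 1))
                (Finset.sum_nonneg fun _ _ => by positivity) hf.le
        have h2 : (0 : ℝ) < (n + 1 - i).factorial := by exact_mod_cast Nat.factorial_pos _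
        rw [P_cast, Nat.factorial_succ n]
        push_cast
        calc _ ≤ (((n : ℝ) + 1) * n.factorial / (n + 1 - i).factorial *
              (n.factorial * Real.exp 1)) / (((n : ℝ) + 1) * n.factorial) ^ 2 := by gcongr
          _ = _ := by field_simp
    _ = (∑ i ∈ Finset.Icc 1 n, (1 : ℝ) / (n + 1 - i).factorial) *
          (Real.exp 1 * (1 / ((n : ℝ) + 1))) := by rw [Finset.sum_mul]
    _ ≤ Real.exp 1 * (Real.exp 1 * (1 / ((n : ℝ) + 1))) := by
        gcongr
        calc _ ≤ ∑ i ∈ Finset.range (n + 1 + 1), (1 : ℝ) / (n + 1 - i).factorial := by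
              refine Finset.sum_le_sum_of_subset_of_nonneg ?_ fun _ _ _ => by positivity
              intro i hi
              simp only [Finset.mem_Icc, Finset.mem_range] at *
              omega
          _ = ∑ i ∈ Finset.range (n + 1 + 1), (1 : ℝ) / i.factorial :=
              Finset.sum_flip (fun k : ℕ => (1 : ℝ) / k.factorial)
          _ ≤ _ := sum_inv_le _
    _ = _ := by ring

/-- The normalizing constant Σ_{i=1}^{N} P(N,i)·(F(i)−1) of the maximum-RPS-entropy
permutation mass function is asymptotically e · (N!)²:
lim_{N→∞} (Σ_{i=1}^{N} P(N,i)(F(i)−1)) / (N!)² = e. -/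
theorem limit_max_RPS_normalizer :
    Filter.Tendsto
      (fun N : ℕ =>
        ((∑ i ∈ Finset.Icc 1 N, P N i * (F i - 1) : ℕ) : ℝ) / ((N.factorial : ℝ)) ^ 2)
      Filter.atTop (nhds (Real.exp 1)) := by
  rw [← Filter.tendsto_add_atTop_iff_nat 1]
  have hrest : Filter.Tendsto (fun n : ℕ =>
      ((∑ i ∈ Finset.Icc 1 n, P (n + 1) i * (F i - 1) : ℕ) : ℝ) / ((n + 1).factorial : ℝ) ^ 2)
      Filter.atTop (nhds 0) := by
    refine squeeze_zero (fun n => by positivity) rest_le ?_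
    simpa using (tendsto_one_div_add_atTop_nhds_zero_nat (𝕜 := ℝ)).const_mul
      (Real.exp 1 * Real.exp 1)
  have hinv : Filter.Tendsto (fun n : ℕ => (1 : ℝ) / (n + 1).factorial)
      Filter.atTop (nhds 0) := by
    refine squeeze_zero (fun n => by positivity) (fun n => ?_)
      (tendsto_one_div_add_atTop_nhds_zero_nat (𝕜 := ℝ))
    have : ((n + 1 : ℕ) : ℝ) ≤ (n + 1).factorial := by
      exact_mod_cast Nat.self_le_factorial (n + 1)
    push_cast at this
    gcongr
  have hmain := (sum_inv_tendsto.comp (Filter.tendsto_add_atTop_nat 2)).sub hinv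
  have := hrest.add hmain
  rw [sub_zero, zero_add] at this
  refine this.congr fun n => ?_
  have hf : ((n + 1).factorial : ℝ) ≠ 0 := by exact_mod_cast Nat.factorial_ne_zero _
  rw [Finset.sum_Icc_succ_top (by omega), Nat.cast_add, add_div]
  congr 1
  rw [Nat.cast_mul, Nat.cast_sub (F_pos _), P_cast, F_cast]
  simp only [Function.comp, Nat.sub_self, Nat.factorial_zero, Nat.cast_one, div_one]
  field_simp
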